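/- Suppose assumption (H1) holds with Ω semi-algebraic, the feasible set {(x,y) ∈ A ∩ B : J(x,y) ≥ 0} of problem (P) is nonempty, and the function J is continuous on Ω. Then there exist ε̄ > 0, a rational number q > 0, and a constant c ≤ 0 such that for all ε ∈ [0, ε̄], val(P_ε) = val(P) + c ε^q + o(ε^q) as ε → 0⁺. -/

import Mathlib

open MvPolynomial Set Filter Asymptotics

/-- A set `S ⊆ ℝ^ι` is semi-algebraic if it is a finite union of sets each given by
finitely many polynomial equations `p = 0` and finitely many strict polynomial
inequalities `p > 0`. -/
def IsSemialgebraic {ι : Type} (S : Set (ι → ℝ)) : Prop :=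
  ∃ (q : ℕ) (E P : Fin q → Finset (MvPolynomial ι ℝ)),
    S = ⋃ i : Fin q, {z | (∀ p ∈ E i, MvPolynomial.eval z p = 0) ∧
      ∀ p ∈ P i, 0 < MvPolynomial.eval z p}

/-- Two reals that compare in the same way with every element of `D`. -/
def SameCell (D : Set ℝ) (x y : ℝ) : Prop :=
  ∀ c ∈ D, (c < x ↔ c < y) ∧ (x < c ↔ y < c)

namespace SameCell

variable {D : Set ℝ} {x y z : ℝ}

theorem refl (D : Set ℝ) (x : ℝ) : SameCell D x x := fun _ _ => ⟨Iff.rfl, Iff.rfl⟩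

theorem symm (h : SameCell D x y) : SameCell D y x :=
  fun c hc => ⟨(h c hc).1.symm, (h c hc).2.symm⟩

theorem trans (h : SameCell D x y) (h' : SameCell D y z) : SameCell D x z :=
  fun c hc => ⟨(h c hc).1.trans (h' c hc).1, (h c hc).2.trans (h' c hc).2⟩

theorem eq_of_mem (h : SameCell D x y) (hx : x ∈ D) : x = y := by
  have := h x hx
  rcases lt_trichotomy x y with h1 | h1 | h1
  · exact absurd (this.1.2 h1) (lt_irrefl _)
  · exact h1
  · exact absurd (this.2.2 h1) (lt_irrefl _)

theorem of_mem_uIcc (h : SameCell D x y) (hz : z ∈ uIcc x y) : SameCell D x z := by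
  intro c hc
  have := h c hc
  rcases le_total x y with hxy | hxy
  · rw [uIcc_of_le hxy] at hz
    exact ⟨⟨fun a => a.trans_le hz.1, fun a => this.1.2 (a.trans_le hz.2)⟩,
      ⟨fun a => hz.2.trans_lt (this.2.1 a), fun a => hz.1.trans_lt a⟩⟩
  · rw [uIcc_of_ge hxy] at hz
    exact ⟨⟨fun a => (this.1.1 a).trans_le hz.1, fun a => a.trans_le hz.2⟩,
      ⟨fun a => hz.2.trans_lt a, fun a => this.2.2 (hz.1.trans_lt a)⟩⟩

theorem image_iff (ψ : ℝ ≃o ℝ) : SameCell (ψ '' D) (ψ x) (ψ y) ↔ SameCell D x y := by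
  simp [SameCell]

theorem of_eqOn {θ ψ : ℝ ≃o ℝ} (h : ∀ c ∈ D, θ c = ψ c) (x : ℝ) :
    SameCell (ψ '' D) (ψ x) (θ x) := by
  rintro _ ⟨c, hc, rfl⟩
  rw [ψ.lt_iff_lt, ψ.lt_iff_lt, ← h c hc, θ.lt_iff_lt, θ.lt_iff_lt]
  exact ⟨Iff.rfl, Iff.rfl⟩

end SameCell

theorem sign_eq_of_forall_uIcc_ne_zero {f : ℝ → ℝ} (hf : Continuous f) {x y : ℝ}
    (h : ∀ t ∈ uIcc x y, f t ≠ 0) : SignType.sign (f x) = SignType.sign (f y) := by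
  by_contra hne
  have hx := h x left_mem_uIcc
  have hy := h y right_mem_uIcc
  have h0 : (0 : ℝ) ∈ uIcc (f x) (f y) := by
    rcases lt_or_gt_of_ne hx with h1 | h1 <;> rcases lt_or_gt_of_ne hy with h2 | h2
    · simp [sign_neg h1, sign_neg h2] at hne
    · exact mem_uIcc.2 (Or.inl ⟨h1.le, h2.le⟩)
    · exact mem_uIcc.2 (Or.inr ⟨h2.le, h1.le⟩)
    · simp [sign_pos h1, sign_pos h2] at hne
  obtain ⟨t, ht, ht0⟩ := intermediate_value_uIcc hf.continuousOn h0
  exact h t ht ht0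

theorem SameCell.sign_eq {D : Set ℝ} {f : ℝ → ℝ} (hf : Continuous f)
    (hD : ∀ t, f t = 0 → t ∈ D) {x y : ℝ} (h : SameCell D x y) :
    SignType.sign (f x) = SignType.sign (f y) := by
  by_cases hx : x ∈ D
  · rw [h.eq_of_mem hx]
  · refine sign_eq_of_forall_uIcc_ne_zero hf fun t ht h0 => hx ?_
    have := (h.of_mem_uIcc ht).symm.eq_of_mem (hD t h0)
    exact this ▸ hD t h0

/-- The mean value theorem in terms of signs, on a set where the derivative has constant sign. -/
theorem sign_eval_sub_eval {D : Set ℝ} {f : Polynomial ℝ}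
    (hD : ∀ t, f.derivative.eval t = 0 → t ∈ D) {x a : ℝ} (h : SameCell D x a) :
    SignType.sign (f.eval x - f.eval a) =
      SignType.sign (f.derivative.eval x) * SignType.sign (x - a) := by
  have key : ∀ u v : ℝ, u < v → SameCell D u v →
      SignType.sign (f.eval v - f.eval u) = SignType.sign (f.derivative.eval u) := by
    intro u v huv huv'
    obtain ⟨t, ht, hts⟩ := exists_deriv_eq_slope (fun x => f.eval x) huv
      f.continuous.continuousOn f.differentiable.differentiableOn
    rw [Polynomial.deriv] at hts
    have hs := SameCell.sign_eq f.derivative.continuous hD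
      (huv'.of_mem_uIcc (by rw [uIcc_of_le huv.le]; exact ⟨ht.1.le, ht.2.le⟩))
    rw [hs, hts, div_eq_mul_inv, sign_mul,
      sign_pos (inv_pos.2 (sub_pos.2 huv)), mul_one]
  rcases lt_trichotomy x a with hxa | rfl | hxa
  · rw [← neg_sub, Left.sign_neg, key x a hxa h, sign_neg (sub_neg.2 hxa)]
    simp
  · simp
  · rw [key a x hxa h.symm, sign_pos (sub_pos.2 hxa), mul_one]
    exact SameCell.sign_eq f.derivative.continuous hD h.symm

theorem exists_orderIso_of_lt {p q : ℝ} (hpq : p < q) {D : Set ℝ} (hD : D.Finite)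
    (h : ∀ t ∈ Icc p q, t ∉ D) :
    ∃ μ : ℝ ≃o ℝ, μ p = q ∧ ∀ c ∈ D, μ c = c := by
  have hnhds : ∀ t ∈ Icc p q, Dᶜ ∈ nhds t := fun t ht =>
    hD.isClosed.isOpen_compl.mem_nhds (h t ht)
  obtain ⟨l, hl, hlD⟩ := exists_Ioc_subset_of_mem_nhds (hnhds p ⟨le_rfl, hpq.le⟩) ⟨p - 1, by simp⟩
  obtain ⟨u, hu, huD⟩ := exists_Ico_subset_of_mem_nhds (hnhds q ⟨hpq.le, le_rfl⟩) ⟨q + 1, by simp⟩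
  set α := (q - l) / (p - l) with hα
  set β := (u - q) / (u - p) with hβ
  have hα1 : 1 < α := by rw [hα, one_lt_div (by linarith)]; linarith
  have hβ0 : 0 < β := div_pos (by linarith) (by linarith)
  have hβ1 : β < 1 := by rw [hβ, div_lt_one (by linarith)]; linarith
  let F : ℝ → ℝ := fun x => max x (min (l + α * (x - l)) (u - β * (u - x)))
  have hmono : StrictMono F := by
    intro x y hxy
    refine max_lt_max hxy (min_lt_min ?_ ?_) <;> nlinarith
  have hlow : ∀ x, x ≤ l → F x = x := fun x hx =>
    max_eq_left (min_le_of_left_le (by nlinarith))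
  have hhigh : ∀ x, u ≤ x → F x = x := fun x hx =>
    max_eq_left (min_le_of_right_le (by nlinarith))
  have hcont : Continuous F := by fun_prop
  have hsurj : Function.Surjective F := by
    refine hcont.surjective (tendsto_atTop_mono (fun x => le_max_left _ _) tendsto_id) ?_
    refine tendsto_id.congr' ?_
    filter_upwards [eventually_le_atBot l] with x hx
    exact (hlow x hx).symm
  refine ⟨hmono.orderIsoOfSurjective F hsurj, ?_, fun c hc => ?_⟩
  · change F p = q
    have h1 : l + α * (p - l) = q := by
      rw [hα, div_mul_cancel₀ _ (by linarith)]; ring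
    have h2 : u - β * (u - p) = q := by
      rw [hβ, div_mul_cancel₀ _ (by linarith)]; ring
    simp only [F, h1, h2, min_self, max_eq_right hpq.le]
  · change F c = c
    by_cases hcl : c ≤ l
    · exact hlow c hcl
    by_cases hcu : u ≤ c
    · exact hhigh c hcu
    push Not at hcl hcu
    rcases le_or_gt c p with h1 | h1
    · exact absurd hc (hlD ⟨hcl, h1⟩)
    rcases le_or_gt q c with h2 | h2
    · exact absurd hc (huD ⟨h2, hcu⟩)
    · exact absurd hc (h c ⟨h1.le, h2.le⟩)

/-- An order automorphism of the line moving one point to another while fixing finitely many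
points that do not lie between them. -/
theorem exists_orderIso_apply_eq {p q : ℝ} {D : Set ℝ} (hD : D.Finite)
    (h : ∀ t ∈ uIcc p q, t ∉ D) :
    ∃ μ : ℝ ≃o ℝ, μ p = q ∧ ∀ c ∈ D, μ c = c := by
  rcases lt_trichotomy p q with hpq | rfl | hpq
  · exact exists_orderIso_of_lt hpq hD (by rwa [uIcc_of_le hpq.le] at h)
  · exact ⟨OrderIso.refl ℝ, rfl, fun _ _ => rfl⟩
  · obtain ⟨μ, h1, h2⟩ := exists_orderIso_of_lt hpq hD (by rwa [uIcc_of_ge hpq.le] at h)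
    exact ⟨μ.symm, by rw [← h1, μ.symm_apply_apply],
      fun c hc => by rw [OrderIso.symm_apply_eq, h2 c hc]⟩

/-- The conjugate of an order automorphism of the line by `x ↦ -x`. -/
def OrderIso.conjNeg (ψ : ℝ ≃o ℝ) : ℝ ≃o ℝ :=
  ((OrderIso.neg ℝ).trans ψ.dual).trans (OrderIso.neg ℝ).symm

@[simp]
theorem OrderIso.conjNeg_apply (ψ : ℝ ≃o ℝ) (x : ℝ) : ψ.conjNeg x = -ψ (-x) := rfl

/-- The order automorphism `ψ` matches the signs of the derivatives of `f` and `g` everywhere, and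
the signs of `f` and `g` on a finite set `D` containing the critical points of `f`. -/
structure DerivMatch (D : Set ℝ) (f g : Polynomial ℝ) (ψ : ℝ ≃o ℝ) : Prop where
  finite : D.Finite
  crit : ∀ t, f.derivative.eval t = 0 → t ∈ D
  deriv : ∀ t, SignType.sign (f.derivative.eval t) = SignType.sign (g.derivative.eval (ψ t))
  on : ∀ c ∈ D, SignType.sign (f.eval c) = SignType.sign (g.eval (ψ c))

namespace DerivMatch

variable {D : Set ℝ} {f g : Polynomial ℝ} {ψ θ : ℝ ≃o ℝ}

theorem neg (h : DerivMatch D f g ψ) : DerivMatch D (-f) (-g) ψ where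
  finite := h.finite
  crit t ht := h.crit t (by simpa using ht)
  deriv t := by simp [Left.sign_neg, h.deriv]
  on c hc := by simp [Left.sign_neg, h.on c hc]

theorem crit_right (h : DerivMatch D f g ψ) (t : ℝ) (ht : g.derivative.eval t = 0) :
    t ∈ ψ '' D := by
  refine ⟨ψ.symm t, h.crit _ ?_, ψ.apply_symm_apply t⟩
  have := h.deriv (ψ.symm t)
  rwa [ψ.apply_symm_apply, ht, sign_zero, sign_eq_zero_iff] at this

theorem symm (h : DerivMatch D f g ψ) : DerivMatch (ψ '' D) g f ψ.symm where
  finite := h.finite.image _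
  crit := h.crit_right
  deriv t := by simpa using (h.deriv (ψ.symm t)).symm
  on := by
    rintro _ ⟨c, hc, rfl⟩
    simpa using (h.on c hc).symm

theorem of_eqOn (h : DerivMatch D f g ψ) (hθ : ∀ c ∈ D, θ c = ψ c) : DerivMatch D f g θ where
  finite := h.finite
  crit := h.crit
  deriv t := (h.deriv t).trans <| SameCell.sign_eq g.derivative.continuous h.crit_right <|
    SameCell.of_eqOn hθ t
  on c hc := by rw [hθ c hc, h.on c hc]

/-- Precomposition with `x ↦ -x`. -/
theorem reflect (h : DerivMatch D f g ψ) :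
    DerivMatch (Neg.neg '' D) (f.comp (-Polynomial.X)) (g.comp (-Polynomial.X))
      ψ.conjNeg where
  finite := h.finite.image _
  crit t ht := ⟨-t, h.crit _ (by simpa [Polynomial.derivative_comp] using ht), neg_neg t⟩
  deriv t := by simpa [Polynomial.derivative_comp, Left.sign_neg] using h.deriv (-t)
  on := by
    rintro _ ⟨c, hc, rfl⟩
    simpa using h.on c hc

theorem exists_pos_of_deriv_pos (h : DerivMatch D f g ψ) {x : ℝ} (hx : 0 < f.eval x)
    (hx' : 0 < f.derivative.eval x) :
    ∃ y, SameCell (ψ '' D) (ψ x) y ∧ 0 < g.eval y := by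
  by_cases hxD : x ∈ D
  · refine ⟨ψ x, SameCell.refl _ _, ?_⟩
    rw [← sign_eq_one_iff, ← h.on x hxD, sign_pos hx]
  by_cases hc : ∃ c ∈ D, x < c
  · have hfin : (D ∩ Ioi x).Finite := h.finite.subset inter_subset_left
    obtain ⟨c, ⟨hcD, hxc⟩, hmin⟩ := hfin.exists_minimal (by simpa [Set.Nonempty] using hc)
    have hmin' : ∀ d ∈ D, x < d → c ≤ d := fun d hd hxd => by
      by_contra hcd
      exact hcd (hmin ⟨hd, hxd⟩ (le_of_not_ge hcd))
    have hcell : ∀ y, x ≤ y → y < c → SameCell D x y := by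
      intro y hxy hyc d hd
      have hdx : d ≠ x := fun e => hxD (e ▸ hd)
      refine ⟨⟨fun a => a.trans_le hxy, fun a => ?_⟩, ⟨fun a => hyc.trans_le (hmin' d hd a),
        fun a => hxy.trans_lt a⟩⟩
      rcases lt_or_gt_of_ne hdx with h1 | h1
      · exact h1
      · exact absurd (hmin' d hd h1) (by linarith)
    have hfc : f.eval x < f.eval c := by
      obtain ⟨t, ht, hts⟩ := exists_deriv_eq_slope (fun x => f.eval x) hxc
        f.continuous.continuousOn f.differentiable.differentiableOn
      rw [Polynomial.deriv] at hts
      have hs := SameCell.sign_eq f.derivative.continuous h.crit (hcell t ht.1.le ht.2)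
      rw [sign_pos hx', hts, eq_comm, sign_eq_one_iff] at hs
      exact sub_pos.1 ((div_pos_iff_of_pos_right (sub_pos.2 hxc)).1 hs)
    have hgc : 0 < g.eval (ψ c) := by
      rw [← sign_eq_one_iff, ← h.on c hcD, sign_pos (hx.trans hfc)]
    obtain ⟨l, hl, hlD⟩ := exists_Ioc_subset_of_mem_nhds
      ((g.continuous.tendsto (ψ c)).eventually (lt_mem_nhds hgc)) ⟨ψ c - 1, by simp⟩
    obtain ⟨y, hy1, hy2⟩ := exists_between (max_lt hl (ψ.lt_iff_lt.2 hxc))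
    refine ⟨y, ?_, hlD ⟨(le_max_left _ _).trans_lt hy1, hy2.le⟩⟩
    rw [← ψ.apply_symm_apply y, SameCell.image_iff]
    refine hcell _ ?_ ?_
    · rw [ψ.le_symm_apply]
      exact (le_max_right _ _).trans hy1.le
    · rwa [ψ.symm_apply_lt]
  · push Not at hc
    have hcell : ∀ y, ψ x ≤ y → SameCell (ψ '' D) (ψ x) y := by
      rintro y hxy _ ⟨d, hd, rfl⟩
      have hdx : d < x := lt_of_le_of_ne (hc d hd) fun e => hxD (e ▸ hd)
      have := ψ.lt_iff_lt.2 hdx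
      exact ⟨⟨fun _ => this.trans_le hxy, fun _ => this⟩, ⟨fun a => absurd a this.not_gt,
        fun a => absurd a (this.trans_le hxy).not_gt⟩⟩
    have hg' : 0 < g.derivative.eval (ψ x) := by
      rw [← sign_eq_one_iff, ← h.deriv x, sign_pos hx']
    have hdeg : 0 < g.degree := by
      by_contra hd
      rw [Polynomial.eq_C_of_degree_le_zero (not_lt.1 hd)] at hg'
      simp at hg'
    obtain ⟨y, hy1, hy2⟩ := (((g.abs_tendsto_atTop hdeg).eventually_gt_atTop
      |g.eval (ψ x)|).and (eventually_gt_atTop (ψ x))).exists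
    refine ⟨y, hcell y hy2.le, ?_⟩
    have := sign_eval_sub_eval h.crit_right (hcell y hy2.le).symm
    rw [sign_pos (sub_pos.2 hy2), mul_one, ← SameCell.sign_eq g.derivative.continuous
      h.crit_right (hcell y hy2.le), sign_pos hg', sign_eq_one_iff] at this
    by_contra hneg
    rw [abs_of_nonpos (not_lt.1 hneg)] at hy1
    linarith [neg_abs_le (g.eval (ψ x))]

theorem exists_pos (h : DerivMatch D f g ψ) {x : ℝ} (hx : 0 < f.eval x) :
    ∃ y, SameCell (ψ '' D) (ψ x) y ∧ 0 < g.eval y := by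
  rcases lt_trichotomy (f.derivative.eval x) 0 with hx' | hx' | hx'
  · obtain ⟨y, hy, hgy⟩ := h.reflect.exists_pos_of_deriv_pos (x := -x) (by simpa using hx)
      (by simpa [Polynomial.derivative_comp] using hx')
    refine ⟨-y, ?_, by simpa using hgy⟩
    rintro _ ⟨d, hd, rfl⟩
    have := hy (-ψ d) ⟨-d, ⟨d, hd, rfl⟩, by simp⟩
    simpa [lt_neg, neg_lt, and_comm] using this
  · refine ⟨ψ x, SameCell.refl _ _, ?_⟩
    rw [← sign_eq_one_iff, ← h.on x (h.crit x hx'), sign_pos hx]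
  · exact h.exists_pos_of_deriv_pos hx hx'

theorem exists_neg (h : DerivMatch D f g ψ) {x : ℝ} (hx : f.eval x < 0) :
    ∃ y, SameCell (ψ '' D) (ψ x) y ∧ g.eval y < 0 := by
  simpa using h.neg.exists_pos (x := x) (by simpa using hx)

theorem exists_zero (h : DerivMatch D f g ψ) {x : ℝ} (hx : f.eval x = 0) :
    ∃ y, SameCell (ψ '' D) (ψ x) y ∧ g.eval y = 0 := by
  by_cases hxD : x ∈ D
  · refine ⟨ψ x, SameCell.refl _ _, ?_⟩
    rw [← sign_eq_zero_iff, ← h.on x hxD, hx, sign_zero]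
  obtain ⟨l, u, ⟨hlx, hxu⟩, hlu⟩ := mem_nhds_iff_exists_Ioo_subset.1
    (h.finite.isClosed.isOpen_compl.mem_nhds hxD)
  obtain ⟨a, hla, hax⟩ := exists_between hlx
  obtain ⟨b, hxb, hbu⟩ := exists_between hxu
  have hcell : ∀ y, l < y → y < u → SameCell D x y := by
    intro y hly hyu d hd
    have hd' : ¬ (l < d ∧ d < u) := fun e => hlu e hd
    by_cases hld : l < d
    · have : u ≤ d := not_lt.1 fun e => hd' ⟨hld, e⟩
      exact ⟨⟨fun _ => by linarith, fun _ => by linarith⟩,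
        ⟨fun _ => by linarith, fun _ => by linarith⟩⟩
    · push Not at hld
      exact ⟨⟨fun _ => by linarith, fun _ => by linarith⟩,
        ⟨fun _ => by linarith, fun _ => by linarith⟩⟩
  have ha := hcell a hla (by linarith)
  have hb := hcell b (by linarith) hbu
  have hsa := sign_eval_sub_eval h.crit ha
  have hsb := sign_eval_sub_eval h.crit hb
  rw [hx, zero_sub, Left.sign_neg, sign_pos (sub_pos.2 hax)] at hsa
  rw [hx, zero_sub, Left.sign_neg, sign_neg (sub_neg.2 hxb)] at hsb
  have hlift : ∀ {z y}, SameCell D x z → SameCell (ψ '' D) (ψ z) y → SameCell (ψ '' D) (ψ x) y :=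
    fun h1 h2 => ((SameCell.image_iff ψ).2 h1).trans h2
  have hends : ∃ y₁ y₂, SameCell (ψ '' D) (ψ x) y₁ ∧ SameCell (ψ '' D) (ψ x) y₂ ∧
      g.eval y₁ < 0 ∧ 0 < g.eval y₂ := by
    rcases lt_trichotomy (f.derivative.eval x) 0 with hx' | hx' | hx'
    · rw [sign_neg hx'] at hsa hsb
      have hfa : 0 < f.eval a := by
        rw [← sign_eq_one_iff]; revert hsa; cases SignType.sign (f.eval a) <;> decide
      have hfb : f.eval b < 0 := by
        rw [← sign_eq_neg_one_iff]; revert hsb; cases SignType.sign (f.eval b) <;> decide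
      obtain ⟨y₁, h1, h1'⟩ := h.exists_neg hfb
      obtain ⟨y₂, h2, h2'⟩ := h.exists_pos hfa
      exact ⟨y₁, y₂, hlift hb h1, hlift ha h2, h1', h2'⟩
    · exact absurd (h.crit x hx') hxD
    · rw [sign_pos hx'] at hsa hsb
      have hfa : f.eval a < 0 := by
        rw [← sign_eq_neg_one_iff]; revert hsa; cases SignType.sign (f.eval a) <;> decide
      have hfb : 0 < f.eval b := by
        rw [← sign_eq_one_iff]; revert hsb; cases SignType.sign (f.eval b) <;> decide
      obtain ⟨y₁, h1, h1'⟩ := h.exists_neg hfa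
      obtain ⟨y₂, h2, h2'⟩ := h.exists_pos hfb
      exact ⟨y₁, y₂, hlift ha h1, hlift hb h2, h1', h2'⟩
  obtain ⟨y₁, y₂, hy₁, hy₂, h1, h2⟩ := hends
  obtain ⟨y, hy, hy0⟩ := intermediate_value_uIcc (f := fun t => g.eval t) (a := y₁) (b := y₂)
    g.continuous.continuousOn (mem_uIcc.2 (Or.inl ⟨h1.le, h2.le⟩))
  exact ⟨y, hy₁.trans ((hy₁.symm.trans hy₂).of_mem_uIcc hy), hy0⟩

theorem exists_sign_eq (h : DerivMatch D f g ψ) (x : ℝ) :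
    ∃ y, SameCell (ψ '' D) (ψ x) y ∧ SignType.sign (g.eval y) = SignType.sign (f.eval x) := by
  rcases lt_trichotomy (f.eval x) 0 with hx | hx | hx
  · obtain ⟨y, hy, hy'⟩ := h.exists_neg hx
    exact ⟨y, hy, by rw [sign_neg hx, sign_neg hy']⟩
  · obtain ⟨y, hy, hy'⟩ := h.exists_zero hx
    exact ⟨y, hy, by rw [hx, hy']⟩
  · obtain ⟨y, hy, hy'⟩ := h.exists_pos hx
    exact ⟨y, hy, by rw [sign_pos hx, sign_pos hy']⟩

theorem eq_of_zero_of_zero (h : DerivMatch D f g ψ) {a b : ℝ} (ha : f.eval a = 0)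
    (hb : f.eval b = 0) (hab : SameCell D a b) : a = b := by
  by_cases haD : a ∈ D
  · exact hab.eq_of_mem haD
  have := sign_eval_sub_eval h.crit hab
  rw [ha, hb, sub_self, sign_zero, zero_eq_mul, sign_eq_zero_iff, sign_eq_zero_iff,
    sub_eq_zero] at this
  exact this.resolve_left fun h0 => haD (h.crit a h0)

theorem exists_zeros_match (h : DerivMatch D f g ψ) {T : Set ℝ} (hT : T.Finite)
    (hT0 : ∀ a ∈ T, f.eval a = 0) :
    ∃ θ : ℝ ≃o ℝ, (∀ c ∈ D, θ c = ψ c) ∧ ∀ a ∈ T, g.eval (θ a) = 0 := by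
  induction T, hT using Set.Finite.induction_on with
  | empty => exact ⟨ψ, fun _ _ => rfl, by simp⟩
  | @insert a T haT hT ih =>
    obtain ⟨θ, hθ, hθT⟩ := ih fun b hb => hT0 b (mem_insert_of_mem _ hb)
    have hm := h.of_eqOn hθ
    have ha0 := hT0 a (mem_insert _ _)
    by_cases haD : a ∈ D
    · refine ⟨θ, hθ, ?_⟩
      rintro b (rfl | hb)
      · rw [← sign_eq_zero_iff, ← hm.on b haD, ha0, sign_zero]
      · exact hθT b hb
    obtain ⟨y, hy, hy0⟩ := hm.exists_zero ha0
    obtain ⟨μ, hμ, hμfix⟩ := exists_orderIso_apply_eq (p := θ a) (q := y)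
      ((h.finite.union hT).image θ) (by
        rintro t ht ⟨d, hd, rfl⟩
        have hcell := (SameCell.image_iff θ).1 (hy.of_mem_uIcc ht)
        rcases hd with hd | hd
        · exact haD (hcell.symm.eq_of_mem hd ▸ hd)
        · have := h.eq_of_zero_of_zero ha0 (hT0 d (mem_insert_of_mem _ hd)) hcell
          exact haT (this ▸ hd))
    refine ⟨θ.trans μ, fun c hc => ?_, ?_⟩
    · rw [OrderIso.trans_apply, hμfix _ ⟨c, Or.inl hc, rfl⟩, hθ c hc]
    · rintro b (rfl | hb)
      · rw [OrderIso.trans_apply, hμ, hy0]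
      · rw [OrderIso.trans_apply, hμfix _ ⟨b, Or.inr hb, rfl⟩, hθT b hb]

theorem sign_eq_of_zeros_match (h : DerivMatch D f g ψ)
    (h0 : ∀ a, f.eval a = 0 → g.eval (ψ a) = 0) (x : ℝ) :
    SignType.sign (f.eval x) = SignType.sign (g.eval (ψ x)) := by
  by_cases hz : ∃ a, SameCell D x a ∧ f.eval a = 0
  · obtain ⟨a, hxa, ha⟩ := hz
    have h1 := sign_eval_sub_eval h.crit hxa
    have h2 := sign_eval_sub_eval h.crit_right ((SameCell.image_iff ψ).2 hxa)
    rw [ha, sub_zero] at h1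
    rw [h0 a ha, sub_zero] at h2
    rw [h1, h2, h.deriv]
    congr 1
    rcases lt_trichotomy x a with hlt | rfl | hlt
    · rw [sign_neg (sub_neg.2 hlt), sign_neg (sub_neg.2 (ψ.lt_iff_lt.2 hlt))]
    · simp
    · rw [sign_pos (sub_pos.2 hlt), sign_pos (sub_pos.2 (ψ.lt_iff_lt.2 hlt))]
  · obtain ⟨y, hy, hys⟩ := h.exists_sign_eq x
    rw [← hys]
    refine (sign_eq_of_forall_uIcc_ne_zero g.continuous fun t ht ht0 => hz ?_).symm
    obtain ⟨a, ha, ha0⟩ := h.symm.exists_zero ht0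
    refine ⟨a, ?_, ha0⟩
    have hxt := hy.of_mem_uIcc ht
    rw [← ψ.apply_symm_apply t, SameCell.image_iff] at hxt
    refine hxt.trans ?_
    simpa [← image_comp] using ha

theorem exists_sign_match (h : DerivMatch D f g ψ) (hf : f ≠ 0) :
    ∃ θ : ℝ ≃o ℝ, (∀ c ∈ D, θ c = ψ c) ∧
      ∀ x, SignType.sign (f.eval x) = SignType.sign (g.eval (θ x)) := by
  obtain ⟨θ, hθ, hθ0⟩ := h.exists_zeros_match (T := {a | f.eval a = 0})
    (by simpa [Polynomial.IsRoot] using f.finite_setOfPred_isRoot hf) fun _ => id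
  exact ⟨θ, hθ, (h.of_eqOn hθ).sign_eq_of_zeros_match hθ0⟩

end DerivMatch

/-- The filter of pairs of points at which any given finitely many polynomials have equal signs. -/
def signFilter (ι : Type) : Filter ((ι → ℝ) × (ι → ℝ)) :=
  ⨅ q : MvPolynomial ι ℝ, 𝓟 {p | SignType.sign (eval p.1 q) = SignType.sign (eval p.2 q)}

theorem eventually_sign_eq {ι : Type} (q : MvPolynomial ι ℝ) :
    ∀ᶠ p in signFilter ι, SignType.sign (eval p.1 q) = SignType.sign (eval p.2 q) :=
  mem_iInf_of_mem q (mem_principal_self _)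

theorem eval_map_eraseLead {R : Type*} [CommRing R] (φ : R →+* ℝ) {g : Polynomial R}
    (h : φ g.leadingCoeff = 0) (x : ℝ) :
    ((g.eraseLead).map φ).eval x = (g.map φ).eval x := by
  conv_rhs => rw [← g.eraseLead_add_C_mul_X_pow]
  simp [h, -Polynomial.eraseLead_add_C_mul_X_pow]

theorem eval_map_cancelLeads_of_root {R : Type*} [CommRing R] (φ : R →+* ℝ)
    {f g : Polynomial R} (h : g.natDegree ≤ f.natDegree) {x : ℝ} (hx : (g.map φ).eval x = 0) :
    ((g.cancelLeads f).map φ).eval x = φ g.leadingCoeff * (f.map φ).eval x := by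
  simp [Polynomial.cancelLeads, Nat.sub_eq_zero_of_le h, hx]

theorem map_ne_zero_of_leadingCoeff {R : Type*} [CommRing R] {φ : R →+* ℝ} {g : Polynomial R}
    (h : φ g.leadingCoeff ≠ 0) : g.map φ ≠ 0 := fun h0 => h <| by
  rw [Polynomial.leadingCoeff, ← Polynomial.coeff_map, h0, Polynomial.coeff_zero]

theorem leadingCoeff_derivative_ne_zero {R : Type*} [CommRing R] [IsDomain R] [CharZero R]
    {φ : R →+* ℝ} {f : Polynomial R} (hf : 0 < f.natDegree) (h : φ f.leadingCoeff ≠ 0) :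
    φ f.derivative.leadingCoeff ≠ 0 := by
  rw [Polynomial.leadingCoeff, Polynomial.natDegree_derivative, Polynomial.coeff_derivative,
    Nat.sub_add_cancel hf, map_mul]
  refine mul_ne_zero h ?_
  rw [map_add, map_one, map_natCast]
  positivity

/-- Inductive step of the sign table construction: knowing the signs of the derivative of `f`, of
the other polynomials and of the reductions of `f` by all of these determines the sign of `f`. -/
theorem exists_sign_match_cons {R : Type*} [CommRing R] [IsDomain R] [CharZero R]
    {φ φ' : R →+* ℝ} {f : Polynomial R} {F : Multiset (Polynomial R)} (hf : 0 < f.natDegree)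
    (hdeg : ∀ g ∈ F, g.natDegree ≤ f.natDegree)
    (hlead : ∀ g ∈ f ::ₘ F, φ g.leadingCoeff ≠ 0)
    (hsign : ∀ g ∈ f.derivative ::ₘ F,
      SignType.sign (φ g.leadingCoeff) = SignType.sign (φ' g.leadingCoeff))
    {ψ : ℝ ≃o ℝ}
    (hψ : ∀ g ∈ f.derivative ::ₘ F, ∀ x,
      SignType.sign ((g.map φ).eval x) = SignType.sign ((g.map φ').eval (ψ x)))
    (hψ' : ∀ g ∈ f.derivative ::ₘ F, ∀ x, SignType.sign (((g.cancelLeads f).map φ).eval x) =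
      SignType.sign (((g.cancelLeads f).map φ').eval (ψ x))) :
    ∃ θ : ℝ ≃o ℝ, ∀ g ∈ f ::ₘ F, ∀ x,
      SignType.sign ((g.map φ).eval x) = SignType.sign ((g.map φ').eval (θ x)) := by
  have hlead' : ∀ g ∈ f.derivative ::ₘ F, φ g.leadingCoeff ≠ 0 := by
    intro g hg
    rcases Multiset.mem_cons.1 hg with rfl | hg
    · exact leadingCoeff_derivative_ne_zero hf (hlead f (Multiset.mem_cons_self _ _))
    · exact hlead g (Multiset.mem_cons_of_mem hg)
  have hdeg' : ∀ g ∈ f.derivative ::ₘ F, g.natDegree ≤ f.natDegree := by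
    intro g hg
    rcases Multiset.mem_cons.1 hg with rfl | hg
    · exact (Polynomial.natDegree_derivative_le f).trans (Nat.sub_le _ _)
    · exact hdeg g hg
  have hmem := Multiset.mem_cons_self f.derivative F
  set D : Set ℝ := ⋃ g ∈ {g | g ∈ f.derivative ::ₘ F}, {t | (g.map φ).eval t = 0} with hD
  have hmemD : ∀ {t}, t ∈ D ↔ ∃ g ∈ f.derivative ::ₘ F, (g.map φ).eval t = 0 := by simp [hD]
  have hmatch : DerivMatch D (f.map φ) (f.map φ') ψ :=
    { finite := (Multiset.finite_toSet _).biUnion fun g hg => by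
        simpa [Polynomial.IsRoot] using
          Polynomial.finite_setOfPred_isRoot (map_ne_zero_of_leadingCoeff (hlead' g hg))
      crit := fun t ht => hmemD.2 ⟨_, hmem, by rwa [← Polynomial.derivative_map]⟩
      deriv := fun t => by simpa only [Polynomial.derivative_map] using hψ _ hmem t
      on := fun c hc => by
        obtain ⟨g, hg, hgc⟩ := hmemD.1 hc
        have hgc' : (g.map φ').eval (ψ c) = 0 := by
          rw [← sign_eq_zero_iff, ← hψ g hg c, hgc, sign_zero]
        have h1 := hψ' g hg c
        rw [eval_map_cancelLeads_of_root φ (hdeg' g hg) hgc,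
          eval_map_cancelLeads_of_root φ' (hdeg' g hg) hgc', sign_mul, sign_mul,
          ← hsign g hg] at h1
        exact mul_left_cancel₀ (sign_ne_zero.2 (hlead' g hg)) h1 }
  obtain ⟨θ, hθ, hθf⟩ := hmatch.exists_sign_match
    (map_ne_zero_of_leadingCoeff (hlead f (Multiset.mem_cons_self _ _)))
  refine ⟨θ, fun g hg x => ?_⟩
  rcases Multiset.mem_cons.1 hg with rfl | hg
  · exact hθf x
  have hg' : g ∈ f.derivative ::ₘ F := Multiset.mem_cons_of_mem hg
  rw [hψ g hg' x]
  refine SameCell.sign_eq (g.map φ').continuous (fun t ht => ?_) (SameCell.of_eqOn hθ x)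
  refine ⟨ψ.symm t, hmemD.2 ⟨g, hg', ?_⟩, ψ.apply_symm_apply t⟩
  rw [← sign_eq_zero_iff, hψ g hg', ψ.apply_symm_apply, ht, sign_zero]

/-- The signs of finitely many polynomials in the parameters determine, up to an order automorphism
of the line, the signs of a given finite family of parametrised univariate polynomials. -/
theorem eventually_exists_sign_match {ι : Type}
    (F : Multiset (Polynomial (MvPolynomial ι ℝ))) :
    ∀ᶠ p in signFilter ι, ∃ ψ : ℝ ≃o ℝ, ∀ f ∈ F, ∀ x,
      SignType.sign ((f.map (eval p.1)).eval x) =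
        SignType.sign ((f.map (eval p.2)).eval (ψ x)) := by
  classical
  have hwf : WellFounded fun F G : Multiset (Polynomial (MvPolynomial ι ℝ)) =>
      (F.map Polynomial.natDegree).IsDershowitzMannaLT (G.map Polynomial.natDegree) :=
    InvImage.wf _ Multiset.wellFounded_isDershowitzMannaLT
  induction F using hwf.induction with | _ F ih
  have step : ∀ (f : Polynomial (MvPolynomial ι ℝ)) (F₀ Y : Multiset _), F = f ::ₘ F₀ →
      (∀ g ∈ Y, g.natDegree < f.natDegree) →
      (((F₀ + Y).map Polynomial.natDegree).IsDershowitzMannaLT (F.map Polynomial.natDegree)) := by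
    intro f F₀ Y hF hY
    refine ⟨F₀.map Polynomial.natDegree, Y.map Polynomial.natDegree, {f.natDegree},
      by simp, by simp, ?_, by simpa using hY⟩
    rw [hF, Multiset.map_cons, ← Multiset.singleton_add, add_comm]
  by_cases hconst : ∃ g ∈ F, g.natDegree = 0
  · obtain ⟨g, hg, hg0⟩ := hconst
    obtain ⟨F₀, rfl⟩ := Multiset.exists_cons_of_mem hg
    filter_upwards [ih (F₀ + 0) (step g F₀ 0 rfl (by simp)), eventually_sign_eq (g.coeff 0)]
      with p ⟨ψ, hψ⟩ hp
    refine ⟨ψ, fun f hf x => ?_⟩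
    rcases Multiset.mem_cons.1 hf with rfl | hf
    · rw [Polynomial.eq_C_of_natDegree_eq_zero hg0]
      simpa using hp
    · exact hψ f (by simpa using hf) x
  push Not at hconst
  by_cases hF0 : F = 0
  · exact Eventually.of_forall fun p => ⟨OrderIso.refl ℝ, by simp [hF0]⟩
  obtain ⟨f, hf, hmax⟩ := F.toFinset.exists_max_image Polynomial.natDegree
    (by simpa [Finset.nonempty_iff_ne_empty] using hF0)
  simp only [Multiset.mem_toFinset] at hf hmax
  have hfpos := Nat.pos_of_ne_zero (hconst f hf)
  have h1 : ∀ᶠ p in signFilter ι, ∀ g ∈ F, ∃ ψ : ℝ ≃o ℝ,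
      ∀ f ∈ F.erase g + {g.eraseLead}, ∀ x, SignType.sign ((f.map (eval p.1)).eval x) =
        SignType.sign ((f.map (eval p.2)).eval (ψ x)) := by
    refine (eventually_all_finite (Multiset.finite_toSet F)).2 fun g hg => ?_
    refine ih _ (step g _ _ (Multiset.cons_erase hg).symm ?_)
    simp only [Multiset.mem_singleton, forall_eq]
    have := Nat.pos_of_ne_zero (hconst g hg)
    exact g.eraseLead_natDegree_le.trans_lt (by omega)
  obtain ⟨F₀, rfl⟩ := Multiset.exists_cons_of_mem hf
  have h2 : ∀ᶠ p in signFilter ι, ∀ g ∈ f ::ₘ F₀,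
      SignType.sign (eval p.1 g.leadingCoeff) = SignType.sign (eval p.2 g.leadingCoeff) :=
    (eventually_all_finite (Multiset.finite_toSet _)).2 fun g _ => eventually_sign_eq _
  have h3 : ∀ᶠ p in signFilter ι, ∀ g ∈ f.derivative ::ₘ F₀,
      SignType.sign (eval p.1 g.leadingCoeff) = SignType.sign (eval p.2 g.leadingCoeff) :=
    (eventually_all_finite (Multiset.finite_toSet _)).2 fun g _ => eventually_sign_eq _
  have hderiv : f.derivative.natDegree < f.natDegree :=
    Polynomial.natDegree_derivative_lt hfpos.ne'
  have hdeg : ∀ g ∈ f.derivative ::ₘ F₀, g.natDegree ≤ f.natDegree := by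
    intro g hg
    rcases Multiset.mem_cons.1 hg with rfl | hg
    · exact hderiv.le
    · exact hmax g (Multiset.mem_cons_of_mem hg)
  have h4 := ih (F₀ + (f.derivative ::ₘ (f.derivative ::ₘ F₀).map fun g => g.cancelLeads f))
    (step f F₀ _ rfl (by
      intro g hg
      rcases Multiset.mem_cons.1 hg with rfl | hg
      · exact hderiv
      · obtain ⟨k, hk, rfl⟩ := Multiset.mem_map.1 hg
        exact Polynomial.natDegree_cancelLeads_lt_of_natDegree_le_natDegree (hdeg k hk) hfpos))
  filter_upwards [h1, h2, h3, h4] with p h1 h2 h3 ⟨ψ, hψ⟩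
  by_cases hz : ∃ g ∈ f ::ₘ F₀, eval p.1 g.leadingCoeff = 0
  · obtain ⟨g, hg, hg0⟩ := hz
    have hg0' : eval p.2 g.leadingCoeff = 0 := by
      rw [← sign_eq_zero_iff, ← h2 g hg, hg0, sign_zero]
    obtain ⟨θ, hθ⟩ := h1 g hg
    refine ⟨θ, fun k hk x => ?_⟩
    by_cases hkg : k = g
    · subst hkg
      simpa only [eval_map_eraseLead _ hg0, eval_map_eraseLead _ hg0'] using
        hθ k.eraseLead (by simp) x
    · exact hθ k (Multiset.mem_add.2 (Or.inl ((Multiset.mem_erase_of_ne hkg).2 hk))) x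
  · push Not at hz
    refine exists_sign_match_cons (φ := eval p.1) (φ' := eval p.2) (ψ := ψ) hfpos
      (fun g hg => hdeg g (Multiset.mem_cons_of_mem hg)) hz h3
      (fun g hg x => hψ g ?_ x) (fun g hg x => hψ _ ?_ x)
    · simp only [Multiset.mem_add, Multiset.mem_cons] at hg ⊢
      tauto
    · rw [Multiset.mem_add, Multiset.mem_cons]
      exact Or.inr (Or.inr (Multiset.mem_map_of_mem _ hg))

/-- A predicate whose truth value depends only on the signs of finitely many polynomials. -/
def SignDefinable {ι : Type} (S : (ι → ℝ) → Prop) : Prop :=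
  ∀ᶠ p in signFilter ι, S p.1 ↔ S p.2

theorem tendsto_signFilter_comp {σ τ : Type} (ρ : σ → τ) :
    Tendsto (fun p : (τ → ℝ) × (τ → ℝ) => (p.1 ∘ ρ, p.2 ∘ ρ)) (signFilter τ) (signFilter σ) :=
  tendsto_iInf.2 fun q => tendsto_principal.2 <| by
    simpa [eval_rename] using eventually_sign_eq (rename ρ q)

namespace SignDefinable

variable {ι κ : Type} {S T : (ι → ℝ) → Prop}

theorem congr (h : SignDefinable S) (hST : ∀ z, T z ↔ S z) : SignDefinable T :=
  (funext fun z => propext (hST z) : T = S) ▸ h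

theorem comp (h : SignDefinable S) (ρ : ι → κ) : SignDefinable fun z => S (z ∘ ρ) :=
  (tendsto_signFilter_comp ρ).eventually h

theorem not (h : SignDefinable S) : SignDefinable fun z => ¬ S z :=
  h.mono fun _ hp => not_congr hp

theorem and (hS : SignDefinable S) (hT : SignDefinable T) : SignDefinable fun z => S z ∧ T z := by
  filter_upwards [hS, hT] with p h1 h2 using and_congr h1 h2

theorem imp (hS : SignDefinable S) (hT : SignDefinable T) : SignDefinable fun z => S z → T z := by
  filter_upwards [hS, hT] with p h1 h2 using imp_congr h1 h2

theorem forall_mem {α : Type*} {I : Set α} (hI : I.Finite) {S : α → (ι → ℝ) → Prop}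
    (h : ∀ i ∈ I, SignDefinable (S i)) : SignDefinable fun z => ∀ i ∈ I, S i z := by
  filter_upwards [(eventually_all_finite hI).2 h] with p hp using forall₂_congr hp

theorem forall_finite {α : Type*} [Finite α] {S : α → (ι → ℝ) → Prop}
    (h : ∀ i, SignDefinable (S i)) : SignDefinable fun z => ∀ i, S i z := by
  simpa using forall_mem finite_univ fun i _ => h i

theorem exists_finite {α : Type*} [Finite α] {S : α → (ι → ℝ) → Prop}
    (h : ∀ i, SignDefinable (S i)) : SignDefinable fun z => ∃ i, S i z :=
  (forall_finite fun i => (h i).not).not.congr fun z => by simp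

theorem of_sign (q : MvPolynomial ι ℝ) (p : SignType → Prop) :
    SignDefinable fun z => p (SignType.sign (eval z q)) := by
  filter_upwards [eventually_sign_eq q] with z hz
  rw [hz]

theorem eq_zero (q : MvPolynomial ι ℝ) : SignDefinable fun z => eval z q = 0 :=
  (of_sign q (· = 0)).congr fun _ => sign_eq_zero_iff.symm

theorem pos (q : MvPolynomial ι ℝ) : SignDefinable fun z => 0 < eval z q :=
  (of_sign q (· = 1)).congr fun _ => sign_eq_one_iff.symm

theorem nonneg (q : MvPolynomial ι ℝ) : SignDefinable fun z => 0 ≤ eval z q :=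
  (of_sign q (· ≠ -1)).congr fun _ => by rw [Ne, sign_eq_neg_one_iff, not_lt]

/-- Elimination of an existential quantifier over one real variable. -/
theorem exists_option {S : (Option ι → ℝ) → Prop} (h : SignDefinable S) :
    SignDefinable fun z : ι → ℝ => ∃ t : ℝ, S fun o => o.elim t z := by
  obtain ⟨Q, hQ, hQS⟩ := (hasBasis_iInf_principal_finite _).eventually_iff.1 h
  filter_upwards [eventually_exists_sign_match
    (hQ.toFinset.val.map (optionEquivLeft ℝ ι))] with p ⟨ψ, hψ⟩
  have key : ∀ t, S (fun o => o.elim t p.1) ↔ S (fun o => o.elim (ψ t) p.2) := fun t => by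
    refine hQS (x := (fun o => o.elim t p.1, fun o => o.elim (ψ t) p.2)) ?_
    refine mem_iInter₂.2 fun q hq => ?_
    have := hψ (optionEquivLeft ℝ ι q) (Multiset.mem_map_of_mem _ (by simpa using hq)) t
    rwa [← optionEquivLeft_elim_eval, ← optionEquivLeft_elim_eval] at this
  refine ⟨fun ⟨t, ht⟩ => ⟨ψ t, (key t).1 ht⟩, fun ⟨t, ht⟩ => ⟨ψ.symm t, (key _).2 ?_⟩⟩
  rwa [ψ.apply_symm_apply]

/-- The Tarski–Seidenberg theorem. -/
theorem exists_sum [Finite κ] {S : (ι ⊕ κ → ℝ) → Prop} (h : SignDefinable S) :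
    SignDefinable fun z : ι → ℝ => ∃ y : κ → ℝ, S (Sum.elim z y) := by
  revert S
  refine Finite.induction_empty_option (P := fun κ => ∀ {S : (ι ⊕ κ → ℝ) → Prop},
    SignDefinable S → SignDefinable fun z : ι → ℝ => ∃ y : κ → ℝ, S (Sum.elim z y))
    ?_ ?_ ?_ κ
  · intro α β e ih S h
    refine (ih (h.comp (Sum.map id e.symm))).congr fun z => ?_
    have : ∀ y : α → ℝ, Sum.elim z y ∘ Sum.map id e.symm = Sum.elim z (y ∘ e.symm) := fun y => by
      ext (i | i) <;> rfl
    refine ⟨fun ⟨y, hy⟩ => ⟨y ∘ e, ?_⟩, fun ⟨y, hy⟩ => ⟨y ∘ e.symm, this y ▸ hy⟩⟩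
    simpa [this, Function.comp_assoc] using hy
  · intro S h
    refine (h.comp (Sum.elim id PEmpty.elim)).congr fun z => ?_
    have : ∀ y : PEmpty.{1} → ℝ, Sum.elim z y = z ∘ Sum.elim id PEmpty.elim := fun y => by
      ext (i | i)
      · rfl
      · exact i.elim
    simp [this]
  · intro α _ ih S h
    refine (ih (h.comp (Sum.elim (fun i => some (Sum.inl i))
      fun o => o.elim none fun a => some (Sum.inr a))).exists_option).congr fun z => ?_
    have : ∀ (t : ℝ) (y : α → ℝ), (fun o : Option (ι ⊕ α) => o.elim t (Sum.elim z y)) ∘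
        (Sum.elim (fun i => some (Sum.inl i)) fun o => o.elim none fun a => some (Sum.inr a)) =
        Sum.elim z fun o : Option α => o.elim t y := fun t y => by
      ext (i | (_ | i)) <;> rfl
    simp only [this]
    refine ⟨fun ⟨y, hy⟩ => ⟨y ∘ some, y none, ?_⟩, fun ⟨y, t, hy⟩ => ⟨_, hy⟩⟩
    convert hy using 2
    ext (_ | i) <;> rfl

theorem forall_sum [Finite κ] {S : (ι ⊕ κ → ℝ) → Prop} (h : SignDefinable S) :
    SignDefinable fun z : ι → ℝ => ∀ y : κ → ℝ, S (Sum.elim z y) :=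
  h.not.exists_sum.not.congr fun z => by simp

end SignDefinable

theorem IsSemialgebraic.signDefinable {ι : Type} {S : Set (ι → ℝ)} (h : IsSemialgebraic S) :
    SignDefinable (· ∈ S) := by
  obtain ⟨q, E, P, rfl⟩ := h
  refine (SignDefinable.exists_finite fun i : Fin q =>
    (SignDefinable.forall_mem (E i).finite_toSet fun p _ => SignDefinable.eq_zero p).and
    (SignDefinable.forall_mem (P i).finite_toSet fun p _ => SignDefinable.pos p)).congr
      fun z => ?_
  simp

/-- A function of one variable with definable graph is algebraic. -/
theorem SignDefinable.exists_ne_zero_eval_eq_zero {ι : Type} {S : (Option ι → ℝ) → Prop}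
    (h : SignDefinable S) :
    ∃ P : MvPolynomial (Option ι) ℝ, P ≠ 0 ∧ ∀ (z : ι → ℝ) (t : ℝ),
      (∀ u, S (fun o => o.elim u z) ↔ u = t) → eval (fun o => o.elim t z) P = 0 := by
  classical
  obtain ⟨Q, hQ, hQS⟩ := (hasBasis_iInf_principal_finite _).eventually_iff.1 h
  refine ⟨∏ q ∈ hQ.toFinset with q ≠ 0, q,
    Finset.prod_ne_zero_iff.2 fun q hq => (Finset.mem_filter.1 hq).2, fun z t hS => ?_⟩
  by_contra hP
  rw [map_prod, ← ne_eq, Finset.prod_ne_zero_iff] at hP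
  have hev : ∀ᶠ u in nhds t, ∀ q ∈ Q, SignType.sign (eval (fun o => o.elim u z) q) =
      SignType.sign (eval (fun o : Option ι => o.elim t z) q) := by
    refine (eventually_all_finite hQ).2 fun q hq => ?_
    by_cases hq0 : q = 0
    · simp [hq0]
    have hc : Continuous fun u : ℝ => eval (fun o : Option ι => o.elim u z) q := by
      refine q.continuous_eval.comp (continuous_pi fun o => ?_)
      cases o
      · exact continuous_id
      · exact continuous_const
    have h0 : eval (fun o : Option ι => o.elim t z) q ≠ 0 := hP q (by simp [hq, hq0])
    have := ContinuousAt.comp (f := fun u : ℝ => eval (fun o : Option ι => o.elim u z) q)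
      (continuousAt_sign_of_ne_zero h0) hc.continuousAt
    exact this.eventually (p := (· = SignType.sign (eval (fun o : Option ι => o.elim t z) q)))
      (by rw [nhds_discrete]; exact eventually_pure.2 rfl)
  obtain ⟨u, hu, hut⟩ := ((hev.filter_mono nhdsWithin_le_nhds).and
    (eventually_mem_nhdsWithin (a := t) (s := {t}ᶜ))).exists
  refine hut ((hS u).1 ?_)
  refine (hQS (x := (fun o => o.elim u z, fun o => o.elim t z)) ?_).2 ((hS t).2 rfl)
  exact mem_iInter₂.2 hu

theorem MvPolynomial.exists_eval_unit_eq {a : MvPolynomial Unit ℝ} (ha : a ≠ 0) :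
    ∃ b : Polynomial ℝ, b ≠ 0 ∧ ∀ w, eval (fun _ => w) a = b.eval w := by
  refine ⟨uniqueAlgEquiv ℝ Unit a,
    (map_ne_zero_iff _ (uniqueAlgEquiv ℝ Unit).injective).2 ha, fun w => ?_⟩
  have : (MvPolynomial.aeval fun _ : Unit => w) =
      (Polynomial.aeval (R := ℝ) w).comp (uniqueAlgEquiv ℝ Unit).toAlgHom := by
    ext i
    simp
  simpa [Polynomial.aeval_def, MvPolynomial.aeval_def, Polynomial.eval₂_eq_eval_map] using
    DFunLike.congr_fun this a

theorem Polynomial.exists_eq_X_pow_mul {R : Type*} [CommRing R] {p : Polynomial R} (hp : p ≠ 0) :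
    ∃ k q, p = Polynomial.X ^ k * q ∧ q.coeff 0 ≠ 0 := by
  obtain ⟨q, hq, hq'⟩ := p.exists_eq_pow_rootMultiplicity_mul_and_not_dvd hp 0
  rw [map_zero, sub_zero] at hq hq'
  exact ⟨_, q, hq, fun h => hq' (Polynomial.X_dvd_iff.2 h)⟩

theorem Polynomial.pow_isBigO_eval {b : Polynomial ℝ} (hb : b ≠ 0) {α : Type*} {l : Filter α}
    {w : α → ℝ} (hw : Tendsto w l (nhds 0)) :
    ∃ j : ℕ, (fun x => w x ^ j) =O[l] fun x => b.eval (w x) := by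
  obtain ⟨j, c, rfl, hc⟩ := b.exists_eq_X_pow_mul hb
  rw [Polynomial.coeff_zero_eq_eval_zero] at hc
  have hcw : Tendsto (fun x => c.eval (w x)) l (nhds (c.eval 0)) := (c.continuous.tendsto 0).comp hw
  refine ⟨j, ?_⟩
  have h1 := (isBigO_refl (fun x => (Polynomial.X ^ j * c).eval (w x)) l).mul
    ((hcw.inv₀ hc).isBigO_one ℝ)
  simp only [mul_one] at h1
  refine IsBigO.congr' h1 ?_ EventuallyEq.rfl
  filter_upwards [hcw.eventually_ne hc] with x hx
  simp [mul_assoc, mul_inv_cancel₀ hx]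

/-- An algebraic function of one variable tending to zero at `0⁺` does so at least as fast as some
positive rational power. -/
theorem exists_isLittleO_rpow_of_algebraic {P : MvPolynomial (Option Unit) ℝ} (hP : P ≠ 0)
    {w : ℝ → ℝ} (hw : Tendsto w (nhdsWithin 0 (Ioi 0)) (nhds 0))
    (hPw : ∀ ε > 0, eval (fun o => o.elim (w ε) fun _ => ε) P = 0) :
    ∃ q : ℚ, 0 < q ∧ w =o[nhdsWithin 0 (Ioi 0)] fun ε => ε ^ (q : ℝ) := by
  let Q := rename (Equiv.swap none (some ())) P
  have hQ : Q ≠ 0 := (map_ne_zero_iff _ (rename_injective _ (Equiv.injective _))).2 hP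
  have h : ∀ ε > 0, eval (fun o => o.elim ε fun _ => w ε) Q = 0 := fun ε hε => by
    rw [eval_rename, ← hPw ε hε]
    congr 2
    ext (_ | _) <;> simp
  obtain ⟨k, p, hkp, hp0⟩ := Polynomial.exists_eq_X_pow_mul
    (p := optionEquivLeft ℝ Unit Q) (by simpa using hQ)
  obtain ⟨b, hb, hbeval⟩ := exists_eval_unit_eq hp0
  have hid : Tendsto (fun ε : ℝ => ε) (nhdsWithin 0 (Ioi 0)) (nhds 0) := nhdsWithin_le_nhds
  obtain ⟨G, hG⟩ := (optionEquivLeft ℝ Unit).surjective p.divX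
  have hGlim : Tendsto (fun ε => eval (fun o : Option Unit => o.elim ε fun _ => w ε) G)
      (nhdsWithin 0 (Ioi 0)) (nhds (eval (fun _ => 0) G)) := by
    refine (G.continuous_eval.tendsto _).comp (tendsto_pi_nhds.2 fun o => ?_)
    cases o
    · exact hid
    · exact hw
  have hbw : (fun ε => b.eval (w ε)) =O[nhdsWithin 0 (Ioi 0)] fun ε : ℝ => ε := by
    have h1 := (hGlim.isBigO_one ℝ).mul (isBigO_refl (fun ε : ℝ => ε) (nhdsWithin 0 (Ioi 0)))
    simp only [one_mul] at h1
    refine IsBigO.congr' h1.neg_left ?_ EventuallyEq.rfl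
    filter_upwards [eventually_mem_nhdsWithin] with ε hε
    have h2 := h ε hε
    rw [optionEquivLeft_elim_eval, hkp, Polynomial.map_mul, Polynomial.map_pow, Polynomial.map_X,
      Polynomial.eval_mul, Polynomial.eval_pow, Polynomial.eval_X] at h2
    have h3 := (mul_eq_zero.1 h2).resolve_left (pow_ne_zero _ (ne_of_gt hε))
    rw [← p.divX_mul_X_add, ← hG] at h3
    simp only [Polynomial.map_add, Polynomial.map_mul, Polynomial.map_X, Polynomial.map_C,
      Polynomial.eval_add, Polynomial.eval_mul, Polynomial.eval_X, Polynomial.eval_C] at h3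
    rw [optionEquivLeft_elim_eval, ← hbeval]
    linarith
  obtain ⟨j, hj⟩ := b.pow_isBigO_eval hb hw
  have hwj : (fun ε => w ε ^ (j + 1)) =O[nhdsWithin 0 (Ioi 0)] fun ε : ℝ => ε := by
    simpa [pow_succ] using (hj.trans hbw).mul (hw.isBigO_one ℝ)
  refine ⟨1 / (2 * (j + 1)), by positivity, IsLittleO.of_pow (n := j + 1) ?_ (by simp)⟩
  refine IsBigO.trans_isLittleO (g := fun ε : ℝ => ε) hwj ?_
  have hsqrt : (fun ε : ℝ => ε ^ (1 / 2 : ℝ) * ε ^ (1 / 2 : ℝ)) =o[nhdsWithin 0 (Ioi 0)]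
      fun ε : ℝ => ε ^ (1 / 2 : ℝ) * 1 := by
    refine (isBigO_refl _ _).mul_isLittleO ((isLittleO_one_iff ℝ).2 ?_)
    have := (Real.continuousAt_rpow_const 0 (1 / 2) (Or.inr (by norm_num))).tendsto.comp hid
    simpa [Function.comp_def] using this
  refine hsqrt.congr' ?_ ?_
  · filter_upwards [eventually_mem_nhdsWithin] with ε (hε : 0 < ε)
    rw [← Real.rpow_add hε]
    norm_num
  · filter_upwards [eventually_mem_nhdsWithin] with ε (hε : 0 < ε)
    rw [mul_one, Pi.pow_apply, ← Real.rpow_natCast, ← Real.rpow_mul hε.le]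
    congr 1
    push_cast
    field_simp

theorem SignDefinable.neg_le_eval {σ τ : Type} (ρ : σ → τ) (p : MvPolynomial σ ℝ) (i : τ) :
    SignDefinable fun u : τ → ℝ => -u i ≤ eval (u ∘ ρ) p :=
  (SignDefinable.nonneg (rename ρ p + X i)).congr fun u => by
    rw [map_add, eval_rename, eval_X, neg_le_iff_add_nonneg]

/-- Feasibility of the point `u ∘ Sum.inr` for the problem relaxed by `u (Sum.inl k)`, with the
value function of the inner problem replaced by a universal quantifier. -/
def RelaxedFeasible {α : Type} {n m r s : ℕ} (g : Fin r → MvPolynomial (Fin n ⊕ Fin m) ℝ)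
    (h : Fin s → MvPolynomial (Fin n ⊕ Fin m) ℝ) (φ : MvPolynomial (Fin n ⊕ (Fin m ⊕ Fin m)) ℝ)
    (Ω : Set (Fin n ⊕ Fin m → ℝ)) (k : α) (u : α ⊕ (Fin n ⊕ Fin m) → ℝ) : Prop :=
  u ∘ Sum.inr ∈ Ω ∧ (∀ i, -u (Sum.inl k) ≤ eval (u ∘ Sum.inr) (g i)) ∧
    (∀ j, -u (Sum.inl k) ≤ eval (u ∘ Sum.inr) (h j)) ∧
    ∀ v : Fin m → ℝ, (∀ j, 0 ≤ eval (Sum.elim ((u ∘ Sum.inr) ∘ Sum.inl) v) (h j)) →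
      -u (Sum.inl k) ≤
        eval (Sum.elim ((u ∘ Sum.inr) ∘ Sum.inl) (Sum.elim ((u ∘ Sum.inr) ∘ Sum.inr) v)) φ

theorem signDefinable_relaxedFeasible {α : Type} {n m r s : ℕ}
    (g : Fin r → MvPolynomial (Fin n ⊕ Fin m) ℝ) (h : Fin s → MvPolynomial (Fin n ⊕ Fin m) ℝ)
    (φ : MvPolynomial (Fin n ⊕ (Fin m ⊕ Fin m)) ℝ) {Ω : Set (Fin n ⊕ Fin m → ℝ)}
    (hΩ : IsSemialgebraic Ω) (k : α) :
    SignDefinable (RelaxedFeasible g h φ Ω k) := by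
  refine (hΩ.signDefinable.comp _).and
    ((SignDefinable.forall_finite fun i => SignDefinable.neg_le_eval _ _ _).and
      ((SignDefinable.forall_finite fun j => SignDefinable.neg_le_eval _ _ _).and ?_))
  have key : SignDefinable fun t : (α ⊕ (Fin n ⊕ Fin m)) ⊕ Fin m → ℝ =>
      (∀ j, 0 ≤ eval (t ∘ Sum.elim (Sum.inl ∘ Sum.inr ∘ Sum.inl) Sum.inr) (h j)) →
        -t (Sum.inl (Sum.inl k)) ≤ eval (t ∘ Sum.elim (Sum.inl ∘ Sum.inr ∘ Sum.inl)
          (Sum.elim (Sum.inl ∘ Sum.inr ∘ Sum.inr) Sum.inr)) φ :=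
    (SignDefinable.forall_finite fun j => (SignDefinable.nonneg (h j)).comp _).imp
      (SignDefinable.neg_le_eval _ _ _)
  refine key.forall_sum.congr fun u => forall_congr' fun v => ?_
  have h1 : Sum.elim u v ∘ Sum.elim (Sum.inl ∘ Sum.inr ∘ Sum.inl) Sum.inr =
      Sum.elim ((u ∘ Sum.inr) ∘ Sum.inl) v := by
    ext (i | i) <;> rfl
  have h2 : Sum.elim u v ∘ Sum.elim (Sum.inl ∘ Sum.inr ∘ Sum.inl)
      (Sum.elim (Sum.inl ∘ Sum.inr ∘ Sum.inr) Sum.inr) =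
      Sum.elim ((u ∘ Sum.inr) ∘ Sum.inl) (Sum.elim ((u ∘ Sum.inr) ∘ Sum.inr) v) := by
    ext (i | i | i) <;> rfl
  simp only [h1, h2, Sum.elim_inl]

/-- Under assumption (H1) with `Ω` semi-algebraic, if the feasible set
of (P) is nonempty and `J` is continuous on `Ω`, then there exist `ε̄ > 0`, a rational
`q > 0` and a constant `c ≤ 0` such that for all `ε ∈ [0, ε̄]`,
`val(P_ε) = val(P) + c·ε^q + o(ε^q)` as `ε → 0⁺`. -/
theorem statement_8 (n m r s : ℕ)
    (f : MvPolynomial (Fin n ⊕ Fin m) ℝ)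
    (g : Fin r → MvPolynomial (Fin n ⊕ Fin m) ℝ)
    (h : Fin s → MvPolynomial (Fin n ⊕ Fin m) ℝ)
    (φ : MvPolynomial (Fin n ⊕ (Fin m ⊕ Fin m)) ℝ)
    (A B : Set (Fin n ⊕ Fin m → ℝ))
    (hA : A = {z | ∀ i, 0 ≤ eval z (g i)})
    (hB : B = {z | ∀ j, 0 ≤ eval z (h j)})
    (Bx : (Fin n → ℝ) → Set (Fin m → ℝ))
    (hBx : ∀ x, Bx x = {v | ∀ j, 0 ≤ eval (Sum.elim x v) (h j)})
    -- assumption (H1), with Ω semi-algebraic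
    (Ω : Set (Fin n ⊕ Fin m → ℝ))
    (hΩc : IsCompact Ω) (hΩsa : IsSemialgebraic Ω) (hBΩ : B ⊆ Ω)
    (hne : ∀ x ∈ (fun z : Fin n ⊕ Fin m → ℝ => z ∘ Sum.inl) '' Ω, (Bx x).Nonempty)
    -- the optimal value function J : the minimum is attained and equals J on Ω
    (J : (Fin n ⊕ Fin m → ℝ) → ℝ)
    (hJ : ∀ z ∈ Ω, IsLeast
      ((fun v => eval (Sum.elim (z ∘ Sum.inl) (Sum.elim (z ∘ Sum.inr) v)) φ) ''
        Bx (z ∘ Sum.inl)) (J z))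
    -- J is continuous on Ω
    (hJcont : ContinuousOn J Ω)
    -- the feasible set of (P) is nonempty
    (hfeas : {z | z ∈ A ∩ B ∧ 0 ≤ J z}.Nonempty)
    -- the feasible set of (P_ε)
    (Feas : ℝ → Set (Fin n ⊕ Fin m → ℝ))
    (hFeas : ∀ ε, Feas ε = {z ∈ Ω | (∀ i, -ε ≤ eval z (g i)) ∧
      (∀ j, -ε ≤ eval z (h j)) ∧ -ε ≤ J z})
    -- the value function ε ↦ val(P_ε)
    (valP : ℝ → ℝ)
    (hvalP : ∀ ε, valP ε = sInf ((fun z => eval z f) '' Feas ε)) :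
    ∃ εbar : ℝ, 0 < εbar ∧ ∃ c : ℝ, c ≤ 0 ∧ ∃ q : ℚ, 0 < q ∧
      (fun ε : ℝ => valP ε - (valP 0 + c * ε ^ (q : ℝ)))
        =o[nhdsWithin 0 (Set.Ioi 0)] fun ε : ℝ => ε ^ (q : ℝ) := by
  have hclosed : ∀ p : MvPolynomial (Fin n ⊕ Fin m) ℝ, ∀ a : ℝ, IsClosed {z | a ≤ eval z p} :=
    fun p a => isClosed_le continuous_const p.continuous_eval
  have hcompact : ∀ ε, IsCompact (Feas ε) := fun ε => by
    have : Feas ε = (Ω ∩ J ⁻¹' Ici (-ε)) ∩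
        ((⋂ i, {z | -ε ≤ eval z (g i)}) ∩ ⋂ j, {z | -ε ≤ eval z (h j)}) := by
      ext z
      simp only [hFeas, mem_ofPred_eq, mem_inter_iff, mem_iInter, mem_preimage, mem_Ici]
      tauto
    rw [this]
    exact (hΩc.of_isClosed_subset (hJcont.preimage_isClosed_of_isClosed hΩc.isClosed isClosed_Ici)
      inter_subset_left).inter_right ((isClosed_iInter fun i => hclosed _ _).inter
        (isClosed_iInter fun j => hclosed _ _))
  have hmono : ∀ {ε ε'}, ε ≤ ε' → Feas ε ⊆ Feas ε' := fun hle z hz => by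
    rw [hFeas] at hz ⊢
    have := neg_le_neg hle
    exact ⟨hz.1, fun i => this.trans (hz.2.1 i), fun j => this.trans (hz.2.2.1 j),
      this.trans hz.2.2.2⟩
  have hnonempty : (Feas 0).Nonempty := by
    obtain ⟨z, ⟨hzA, hzB⟩, hzJ⟩ := hfeas
    refine ⟨z, ?_⟩
    rw [hFeas, neg_zero]
    exact ⟨hBΩ hzB, by simpa [hA] using hzA, by simpa [hB] using hzB, hzJ⟩
  have hleast : ∀ ε, 0 ≤ ε → IsLeast ((fun z => eval z f) '' Feas ε) (valP ε) := fun ε hε => by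
    rw [hvalP]
    exact ((hcompact ε).image f.continuous_eval).isLeast_sInf
      ((hnonempty.mono (hmono hε)).image _)
  have hlim : Tendsto (fun ε => valP 0 - valP ε) (nhdsWithin 0 (Ioi 0)) (nhds 0) := by
    refine tendsto_order.2 ⟨fun a ha => ?_, fun δ hδ => ?_⟩
    · filter_upwards [eventually_mem_nhdsWithin] with ε (hε : 0 < ε)
      have := (hleast ε hε.le).2 (image_mono (hmono hε.le) (hleast 0 le_rfl).1)
      linarith
    have hempty : ∃ ε > 0, ¬ (Feas ε ∩ {z | δ - valP 0 ≤ eval z (-f)}).Nonempty := by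
      by_contra! hcon
      obtain ⟨z, hz⟩ := IsCompact.nonempty_iInter_of_directed_nonempty_isCompact_isClosed
        (fun ε : Ioi (0 : ℝ) => Feas ε ∩ {z | δ - valP 0 ≤ eval z (-f)})
        (fun a b => by
          rcases le_total a b with hab | hab
          · exact ⟨a, subset_rfl, inter_subset_inter_left _ (hmono hab)⟩
          · exact ⟨b, inter_subset_inter_left _ (hmono hab), subset_rfl⟩)
        (fun ε => hcon ε ε.2) (fun ε => (hcompact ε).inter_right (hclosed _ _))
        (fun ε => (hcompact ε).isClosed.inter (hclosed _ _))
      rw [mem_iInter] at hz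
      have hz' : ∀ ε : ℝ, 0 < ε → z ∈ Feas ε := fun ε hε => (hz ⟨ε, hε⟩).1
      simp only [hFeas, mem_ofPred_eq] at hz'
      have hz0 : z ∈ Feas 0 := by
        rw [hFeas, neg_zero]
        have hle : ∀ a : ℝ, (∀ ε : ℝ, 0 < ε → -ε ≤ a) → 0 ≤ a := fun a ha =>
          le_of_forall_pos_le_add fun ε hε => by linarith [ha ε hε]
        exact ⟨(hz' 1 one_pos).1, fun i => hle _ fun ε hε => (hz' ε hε).2.1 i,
          fun j => hle _ fun ε hε => (hz' ε hε).2.2.1 j, hle _ fun ε hε => (hz' ε hε).2.2.2⟩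
      have h1 := (hleast 0 le_rfl).2 (mem_image_of_mem _ hz0)
      have h2 := (hz ⟨1, mem_Ioi.2 one_pos⟩).2
      simp only [mem_ofPred_eq, map_neg] at h1 h2
      linarith
    obtain ⟨ε₀, hε₀, hempty⟩ := hempty
    filter_upwards [Ioc_mem_nhdsGT hε₀] with ε hε
    obtain ⟨z, hz, hzε⟩ := (hleast ε hε.1.le).1
    by_contra hcon
    refine hempty ⟨z, hmono hε.2 hz, ?_⟩
    simp only [mem_ofPred_eq, map_neg] at hzε ⊢
    linarith
  have hdef := signDefinable_relaxedFeasible g h φ hΩsa (some ())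
  have hmem : ∀ (z : Option Unit → ℝ) y, RelaxedFeasible g h φ Ω (some ()) (Sum.elim z y) ↔
      y ∈ Feas (z (some ())) := fun z y => by
    rw [hFeas]
    refine and_congr_right fun hy => and_congr_right' (and_congr_right' ?_)
    obtain ⟨⟨v, hv, hvJ⟩, hleJ⟩ := hJ y hy
    rw [hBx] at hv hleJ
    refine ⟨fun H => hvJ ▸ H v hv, fun H v hv => H.trans (hleJ ⟨v, hv, rfl⟩)⟩
  have hvalue (σ : MvPolynomial (Option Unit ⊕ (Fin n ⊕ Fin m)) ℝ)
      (hσ : σ = X (Sum.inl none) - C (valP 0) + rename Sum.inr f) :=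
    (hdef.and (SignDefinable.eq_zero σ)).exists_sum.and
      (hdef.imp (SignDefinable.nonneg σ)).forall_sum
  obtain ⟨P, hP, hPeval⟩ := (hvalue _ rfl).exists_ne_zero_eval_eq_zero
  obtain ⟨q, hq, hqo⟩ := exists_isLittleO_rpow_of_algebraic hP hlim fun ε hε => by
    refine hPeval (fun _ => ε) _ fun u => ?_
    have heval : ∀ y : Fin n ⊕ Fin m → ℝ,
        eval (Sum.elim (fun o : Option Unit => o.elim u fun _ => ε) y)
          (X (Sum.inl none) - C (valP 0) + rename Sum.inr f) = u - valP 0 + eval y f := fun y => by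
      simp [eval_rename]
    simp only [hmem, heval, Option.elim_some]
    obtain ⟨⟨z, hz, hzf⟩, hle⟩ := hleast ε hε.le
    dsimp only at hzf
    constructor
    · rintro ⟨⟨y, hy, hyu⟩, hu⟩
      have h1 := hle (mem_image_of_mem _ hy)
      have h2 := hu z hz
      linarith
    · rintro rfl
      refine ⟨⟨z, hz, by linarith⟩, fun y hy => ?_⟩
      have h1 := hle (mem_image_of_mem _ hy)
      linarith
  refine ⟨1, one_pos, 0, le_rfl, q, hq, ?_⟩
  simpa using hqo.neg_left
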